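/- arXiv:2205.09695 — 4 statements merged into one kernel-verified Lean document; each statement's English description precedes it below -/
import Mathlib

section
/- Let p ≥ 1, let a ≥ b ≥ 0 be real numbers and let ε > 0. Then a^p − b^p ≤ ε·a^p + ((p−1)/ε)^{p−1}·(a−b)^p. -/
/-- The graph of `x ↦ x ^ p` lies above its tangent line at `a`. -/
theorem rpow_tangent_le {p a x : ℝ} (hp : 1 ≤ p) (ha : 0 < a) (hx : 0 ≤ x) :
    a ^ p + p * a ^ (p - 1) * (x - a) ≤ x ^ p := by
  have h := one_add_mul_self_le_rpow_one_add (s := x / a - 1)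
    (by linarith [div_nonneg hx ha.le]) hp
  rw [add_sub_cancel, Real.div_rpow hx ha.le, le_div_iff₀ (Real.rpow_pos_of_pos ha p)] at h
  refine le_of_eq_of_le ?_ h
  rw [Real.rpow_sub_one ha.ne']
  field_simp

/-- Let `p ≥ 1`, `a ≥ b ≥ 0` and `ε > 0`. Then
`a^p − b^p ≤ ε·a^p + ((p−1)/ε)^(p−1)·(a−b)^p` (real powers). -/
theorem stmt_1 (p a b ε : ℝ) (hp : 1 ≤ p) (hb : 0 ≤ b) (hba : b ≤ a) (hε : 0 < ε) :
    a ^ p - b ^ p ≤ ε * a ^ p + ((p - 1) / ε) ^ (p - 1) * (a - b) ^ p := by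
  rcases (hb.trans hba).eq_or_lt with rfl | ha
  · obtain rfl : b = 0 := le_antisymm hba hb
    simp [Real.zero_rpow (by linarith : p ≠ 0)]
  rcases hp.eq_or_lt with rfl | hp1
  · simp only [Real.rpow_one, sub_self, Real.rpow_zero]
    nlinarith
  have hp0 : 0 < p - 1 := sub_pos.2 hp1
  have hk : 0 < (p - 1) / ε := div_pos hp0 hε
  have hd : 0 ≤ a - b := sub_nonneg.2 hba
  have h₁ := rpow_tangent_le hp ha hb
  have h₂ := rpow_tangent_le hp ha (mul_nonneg hk.le hd)
  rw [Real.mul_rpow hk.le hd] at h₂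
  have h₃ := mul_le_mul_of_nonneg_left h₂ (div_pos hε hp0).le
  have h₄ : ε / (p - 1) * (((p - 1) / ε) ^ p * (a - b) ^ p) =
      ((p - 1) / ε) ^ (p - 1) * (a - b) ^ p := by
    rw [Real.rpow_sub_one hk.ne']
    field_simp
  have h₅ : ε / (p - 1) * (a ^ p + p * a ^ (p - 1) * ((p - 1) / ε * (a - b) - a)) =
      p * a ^ (p - 1) * (a - b) - ε * a ^ p := by
    rw [Real.rpow_sub_one ha.ne']
    field_simp
    ring
  rw [h₄, h₅] at h₃
  linarith
end

section
/- Let (Y_n)_{n≥0} be a sequence of positive real numbers satisfying the recursive inequality Y_{n+1} ≤ C·b^n·Y_n^{1+α} for all n ≥ 0, where C > 1, b > 1 and α > 0 are given numbers. If Y_0 ≤ C^{−1/α}·b^{−1/α²}, then Y_n → 0 as n → ∞. -/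
/-- The decay estimate behind geometric convergence: under the recursion
`Y (n+1) ≤ C · b^n · (Y n)^(1+α)` and the smallness of `Y 0`, the sequence decays at the
geometric rate `b^(−1/α)`. -/
theorem le_mul_rpow_of_rec_le (Y : ℕ → ℝ) (C b α : ℝ) (hC : 0 < C) (hb : 0 < b) (hα : 0 < α)
    (hnonneg : ∀ n, 0 ≤ Y n)
    (hrec : ∀ n, Y (n + 1) ≤ C * b ^ (n : ℝ) * Y n ^ (1 + α))
    (h0 : Y 0 ≤ C ^ (-(1 / α)) * b ^ (-(1 / α ^ 2))) (n : ℕ) :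
    Y n ≤ C ^ (-(1 / α)) * b ^ (-(1 / α ^ 2)) * (b ^ (-(1 / α))) ^ n := by
  induction n with
  | zero => simpa using h0
  | succ n ih =>
    have hY := hnonneg n
    calc Y (n + 1) ≤ C * b ^ (n : ℝ) * Y n ^ (1 + α) := hrec n
      _ ≤ C * b ^ (n : ℝ) *
          (C ^ (-(1 / α)) * b ^ (-(1 / α ^ 2)) * (b ^ (-(1 / α))) ^ n) ^ (1 + α) := by
        gcongr
      _ = C ^ (-(1 / α)) * b ^ (-(1 / α ^ 2)) * (b ^ (-(1 / α))) ^ (n + 1) := by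
        rw [← Real.exp_log hC, ← Real.exp_log hb]
        simp only [← Real.exp_mul, ← Real.exp_add, ← Real.exp_nat_mul]
        congr 1
        push_cast
        field_simp
        ring

/-- (Geometric convergence lemma.) Let `(Y n)` be a sequence of positive
reals with `Y (n+1) ≤ C · b^n · (Y n)^(1+α)` for all `n`, where `C > 1`, `b > 1`, `α > 0`.
If `Y 0 ≤ C^(−1/α) · b^(−1/α²)` then `Y n → 0`. -/
theorem stmt_2 (Y : ℕ → ℝ) (C b α : ℝ) (hC : 1 < C) (hb : 1 < b) (hα : 0 < α)
    (hpos : ∀ n, 0 < Y n)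
    (hrec : ∀ n, Y (n + 1) ≤ C * b ^ (n : ℝ) * Y n ^ (1 + α))
    (h0 : Y 0 ≤ C ^ (-(1 / α)) * b ^ (-(1 / α ^ 2))) :
    Filter.Tendsto Y Filter.atTop (nhds 0) := by
  have hb0 : 0 < b := one_pos.trans hb
  have hr : b ^ (-(1 / α)) < 1 :=
    Real.rpow_lt_one_of_one_lt_of_neg hb (neg_lt_zero.mpr (one_div_pos.mpr hα))
  have hlim := (tendsto_pow_atTop_nhds_zero_of_lt_one (Real.rpow_nonneg hb0.le _) hr).const_mul
    (C ^ (-(1 / α)) * b ^ (-(1 / α ^ 2)))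
  rw [mul_zero] at hlim
  exact squeeze_zero (fun n => (hpos n).le)
    (le_mul_rpow_of_rec_le Y C b α (one_pos.trans hC) hb0 hα (fun n => (hpos n).le) hrec h0) hlim
end

section
/- Let N ≥ 1, s ∈ (0,1), p > 1, A ≥ 1 and ρ > 0. There exists a constant C = C(N,s,p,A) > 0 such that for every measurable function u on the ball B_{Aρ} (centered at the origin) and all levels k < l < m: (l−k)·(m−l)^{p−1}·|[u>m]∩B_ρ|·|[u<k]∩B_ρ| ≤ C·ρ^{N+sp}·∫_{B_ρ} (u−l)_−(x) ∫_{B_{Aρ}} (u−l)_+^{p−1}(y)/|x−y|^{N+sp} dy dx. -/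
open MeasureTheory Metric Set
open scoped ENNReal

/-- (Nonlocal isoperimetric-type inequality.) Let `N ≥ 1`, `s ∈ (0,1)`,
`p > 1`, `A ≥ 1`. There is `C = C(N,s,p,A) > 0` such that for every `ρ > 0`, every
measurable `u` and all levels `k < l < m`:
`(l−k)(m−l)^{p−1}|[u>m]∩B_ρ||[u<k]∩B_ρ| ≤ C ρ^{N+sp} ∫_{B_ρ}(u−l)_−(x) ∫_{B_{Aρ}}(u−l)_+^{p−1}(y)/|x−y|^{N+sp} dy dx`,
where the balls are centered at the origin. -/
theorem stmt_5 (N : ℕ) (hN : 1 ≤ N) (s p A : ℝ)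
    (hs : s ∈ Set.Ioo (0 : ℝ) 1) (hp : 1 < p) (hA : 1 ≤ A) :
    ∃ C : ℝ, 0 < C ∧
      ∀ (ρ : ℝ), 0 < ρ → ∀ u : EuclideanSpace ℝ (Fin N) → ℝ, Measurable u →
      ∀ k l m : ℝ, k < l → l < m →
      ENNReal.ofReal ((l - k) * (m - l) ^ (p - 1)) *
          volume {x ∈ ball (0 : EuclideanSpace ℝ (Fin N)) ρ | m < u x} *
          volume {x ∈ ball (0 : EuclideanSpace ℝ (Fin N)) ρ | u x < k}
        ≤ ENNReal.ofReal (C * ρ ^ ((N : ℝ) + s * p)) *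
          ∫⁻ x in ball (0 : EuclideanSpace ℝ (Fin N)) ρ,
            ENNReal.ofReal (l - u x) *
              ∫⁻ y in ball (0 : EuclideanSpace ℝ (Fin N)) (A * ρ),
                ENNReal.ofReal (max (u y - l) 0 ^ (p - 1)) /
                  ENNReal.ofReal (‖x - y‖ ^ ((N : ℝ) + s * p)) := by
  set q : ℝ := (N : ℝ) + s * p
  have hq0 : 0 ≤ q := by
    have := mul_pos hs.1 (zero_lt_one.trans hp)
    positivity
  refine ⟨2 ^ q, by positivity, fun ρ hρ u hu k l m hkl hlm => ?_⟩
  set U := {x ∈ ball (0 : EuclideanSpace ℝ (Fin N)) ρ | m < u x}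
  set L := {x ∈ ball (0 : EuclideanSpace ℝ (Fin N)) ρ | u x < k}
  have hU : MeasurableSet U := measurableSet_ball.inter (measurableSet_lt measurable_const hu)
  have hL : MeasurableSet L := measurableSet_ball.inter (measurableSet_lt hu measurable_const)
  have hUA : U ⊆ ball 0 (A * ρ) := fun y hy =>
    ball_subset_ball (le_mul_of_one_le_left hρ.le hA) hy.1
  have hK : (2 : ℝ) ^ q * ρ ^ q = (2 * ρ) ^ q := (Real.mul_rpow zero_le_two hρ.le).symm
  set K := ENNReal.ofReal (2 ^ q * ρ ^ q)
  have hK0 : K ≠ 0 := (ENNReal.ofReal_pos.2 (by positivity)).ne'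
  set b := ENNReal.ofReal ((m - l) ^ (p - 1))
  have inner_bound : ∀ x ∈ L, b / K * volume U ≤
      ∫⁻ y in ball (0 : EuclideanSpace ℝ (Fin N)) (A * ρ),
        ENNReal.ofReal (max (u y - l) 0 ^ (p - 1)) / ENNReal.ofReal (‖x - y‖ ^ q) := by
    intro x hx
    rw [← setLIntegral_const]
    refine (setLIntegral_mono' hU fun y hy => ?_).trans (lintegral_mono_set hUA)
    have hxy : ‖x - y‖ ≤ 2 * ρ := by
      have h₁ := mem_ball_zero_iff.1 hx.1
      have h₂ := mem_ball_zero_iff.1 hy.1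
      linarith [norm_sub_le x y]
    refine ENNReal.div_le_div (ENNReal.ofReal_le_ofReal ?_) (ENNReal.ofReal_le_ofReal ?_)
    · exact Real.rpow_le_rpow (sub_nonneg.2 hlm.le)
        (le_max_of_le_left (sub_le_sub_right hy.2.le l)) (sub_nonneg.2 hp.le)
    · rw [hK]
      exact Real.rpow_le_rpow (norm_nonneg _) hxy hq0
  have outer_bound : ENNReal.ofReal (l - k) * (b / K * volume U) * volume L ≤
      ∫⁻ x in ball (0 : EuclideanSpace ℝ (Fin N)) ρ, ENNReal.ofReal (l - u x) *
        ∫⁻ y in ball (0 : EuclideanSpace ℝ (Fin N)) (A * ρ),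
          ENNReal.ofReal (max (u y - l) 0 ^ (p - 1)) / ENNReal.ofReal (‖x - y‖ ^ q) := by
    rw [← setLIntegral_const]
    refine (setLIntegral_mono' hL fun x hx => ?_).trans (lintegral_mono_set fun x hx => hx.1)
    exact mul_le_mul' (ENNReal.ofReal_le_ofReal (sub_le_sub_left hx.2.le l)) (inner_bound x hx)
  refine le_trans (le_of_eq ?_) (mul_le_mul_right outer_bound K)
  rw [ENNReal.ofReal_mul (sub_nonneg.2 hkl.le)]
  calc ENNReal.ofReal (l - k) * b * volume U * volume L
      = ENNReal.ofReal (l - k) * (K * (b / K)) * volume U * volume L := by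
        rw [ENNReal.mul_div_cancel hK0 ENNReal.ofReal_ne_top]
    _ = K * (ENNReal.ofReal (l - k) * (b / K * volume U) * volume L) := by ring
end

section
/- Let p > 1. There exists a constant C = C(p) > 0 such that for all real numbers w₁, w₂ ≥ 0 and all ζ₁, ζ₂ ∈ [0,1]: |w₁−w₂|^{p−2}(w₁−w₂)·( w₁·ζ₁^p − w₂·ζ₂^p ) ≥ (1/2)·|w₁−w₂|^p·max{ζ₁,ζ₂}^p − C·max{w₁,w₂}^p·|ζ₁−ζ₂|^p, where the expression |w₁−w₂|^{p−2}(w₁−w₂) is interpreted as 0 when w₁ = w₂. -/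
theorem Real.rpow_sub_rpow_le_mul_sub {p x y : ℝ} (hp : 1 ≤ p) (hx : 0 ≤ x) (hy : 0 < y) :
    y ^ p - x ^ p ≤ p * y ^ (p - 1) * (y - x) := by
  have h := one_add_mul_self_le_rpow_one_add (s := x / y - 1)
    (by linarith [div_nonneg hx hy.le]) hp
  rw [add_sub_cancel, Real.div_rpow hx hy.le, le_div_iff₀ (Real.rpow_pos_of_pos hy p)] at h
  have e : y ^ p = y ^ (p - 1) * y := by
    rw [← Real.rpow_add_one hy.ne', sub_add_cancel]
  have e' : (1 + p * (x / y - 1)) * y ^ p = y ^ p - p * y ^ (p - 1) * (y - x) := by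
    rw [e]
    field_simp
    ring
  linarith

theorem Real.rpow_sub_one_mul_le {p A B : ℝ} (hp : 1 < p) (hA : 0 < A) (hB : 0 ≤ B) :
    A ^ (p - 1) * (p * B) ≤ 1 / 2 * A ^ p + (2 * p) ^ (p - 1) * p * B ^ p := by
  have hp0 : 0 < p := by linarith
  rcases le_total (2 * p * B) A with h | h
  · have e : A ^ p = A ^ (p - 1) * A := by
      rw [← Real.rpow_add_one hA.ne', sub_add_cancel]
    have h1 : A ^ (p - 1) * (p * B) ≤ A ^ (p - 1) * (1 / 2 * A) :=
      mul_le_mul_of_nonneg_left (by linarith) (by positivity)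
    have h2 : 0 ≤ (2 * p) ^ (p - 1) * p * B ^ p := by positivity
    linarith
  · have hB' : 0 < B := pos_of_mul_pos_right (hA.trans_le h) (by positivity)
    have e : B ^ p = B ^ (p - 1) * B := by
      rw [← Real.rpow_add_one hB'.ne', sub_add_cancel]
    have h1 : A ^ (p - 1) * (p * B) ≤ (2 * p * B) ^ (p - 1) * (p * B) := by
      gcongr
    rw [Real.mul_rpow (by positivity) hB] at h1
    have h2 : 0 ≤ A ^ p := by positivity
    rw [e]
    linarith

theorem half_mul_rpow_max_sub_le_of_lt {p a b x y : ℝ} (hp : 1 < p) (hb : 0 ≤ b) (hab : b < a)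
    (hx : 0 ≤ x) (hy : 0 ≤ y) :
    1 / 2 * (a - b) ^ p * max x y ^ p - (2 * p) ^ (p - 1) * p * a ^ p * |x - y| ^ p
      ≤ (a - b) ^ (p - 1) * (a * x ^ p - b * y ^ p) := by
  have hp0 : 0 < p := by linarith
  have hd : 0 < a - b := sub_pos.2 hab
  have ha : 0 < a := hb.trans_lt hab
  have e : (a - b) ^ p = (a - b) ^ (p - 1) * (a - b) := by
    rw [← Real.rpow_add_one hd.ne', sub_add_cancel]
  rcases le_or_gt y x with h | h
  · rw [max_eq_left h]
    have h1 : y ^ p ≤ x ^ p := by gcongr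
    have h2 : (a - b) ^ (p - 1) * ((a - b) * x ^ p)
        ≤ (a - b) ^ (p - 1) * (a * x ^ p - b * y ^ p) := by
      gcongr
      linarith [mul_le_mul_of_nonneg_left h1 hb]
    have h3 : 0 ≤ (2 * p) ^ (p - 1) * p * a ^ p * |x - y| ^ p := by positivity
    have h4 : 0 ≤ (a - b) ^ p * x ^ p := by positivity
    have h5 : (a - b) ^ p * x ^ p = (a - b) ^ (p - 1) * ((a - b) * x ^ p) := by rw [e]; ring
    linarith
  · have hy0 : 0 < y := hx.trans_lt h
    rw [max_eq_right h.le, abs_sub_comm, abs_of_pos (sub_pos.2 h)]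
    have hxy : 0 ≤ y - x := sub_nonneg.2 h.le
    have h1 := Real.rpow_sub_one_mul_le hp (mul_pos hd hy0) (mul_nonneg ha.le hxy)
    rw [Real.mul_rpow hd.le hy, Real.mul_rpow hd.le hy, Real.mul_rpow ha.le hxy] at h1
    have h2 := mul_le_mul_of_nonneg_left (Real.rpow_sub_rpow_le_mul_sub hp.le hx hy0)
      (by positivity : 0 ≤ (a - b) ^ (p - 1) * a)
    have h3 : (a - b) ^ p * y ^ p = (a - b) ^ (p - 1) * ((a - b) * y ^ p) := by rw [e]; ring
    linarith


/-- Let `p > 1`. There is `C = C(p) > 0` such that for all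
`w₁, w₂ ≥ 0` and `ζ₁, ζ₂ ∈ [0,1]`:
`|w₁−w₂|^(p−2)(w₁−w₂)(w₁ζ₁^p − w₂ζ₂^p) ≥ (1/2)|w₁−w₂|^p max{ζ₁,ζ₂}^p − C max{w₁,w₂}^p |ζ₁−ζ₂|^p`.
(With real powers; note that `|w₁−w₂|^(p−2)·(w₁−w₂) = 0` when `w₁ = w₂`, in accordance with
the stated convention, since `0^(p−2)·0 = 0` for `Real.rpow`.) -/
theorem stmt_18 (p : ℝ) (hp : 1 < p) :
    ∃ C : ℝ, 0 < C ∧ ∀ w₁ w₂ ζ₁ ζ₂ : ℝ, 0 ≤ w₁ → 0 ≤ w₂ →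
      ζ₁ ∈ Set.Icc (0 : ℝ) 1 → ζ₂ ∈ Set.Icc (0 : ℝ) 1 →
      (1 / 2) * |w₁ - w₂| ^ p * max ζ₁ ζ₂ ^ p - C * max w₁ w₂ ^ p * |ζ₁ - ζ₂| ^ p
        ≤ |w₁ - w₂| ^ (p - 2) * (w₁ - w₂) * (w₁ * ζ₁ ^ p - w₂ * ζ₂ ^ p) := by
  have hp0 : 0 < p := by linarith
  have key : ∀ d : ℝ, 0 < d → d ^ (p - 2) * d = d ^ (p - 1) := fun d hd => by
    rw [← Real.rpow_add_one hd.ne']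
    congr 1
    ring
  refine ⟨(2 * p) ^ (p - 1) * p, by positivity, fun a b x y ha hb hx hy => ?_⟩
  rcases lt_trichotomy a b with h | rfl | h
  · have h1 := half_mul_rpow_max_sub_le_of_lt hp ha h hy.1 hx.1
    rw [← key _ (sub_pos.2 h)] at h1
    rw [abs_sub_comm a b, abs_of_pos (sub_pos.2 h), max_eq_right h.le, max_comm x y,
      abs_sub_comm x y]
    linarith
  · have h1 : 0 ≤ (2 * p) ^ (p - 1) * p * max a a ^ p * |x - y| ^ p := by
      rw [max_self]
      positivity
    simpa [Real.zero_rpow hp0.ne'] using h1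
  · have h1 := half_mul_rpow_max_sub_le_of_lt hp hb h hx.1 hy.1
    rw [← key _ (sub_pos.2 h)] at h1
    rwa [abs_of_pos (sub_pos.2 h), max_eq_left h.le]
end
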